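/- Let T be a finite tree (connected acyclic simple graph) with a designated root σ, and for each vertex v let β(v) be the product of the degrees Δ_w over all vertices w on the unique path from σ to v excluding v itself (so β(σ) = 1). Then for every real number B > 0, the number of leaves v of T with β(v) ≤ B is at most B. -/

import Mathlib

namespace SimpleGraph

theorem Connected.exists_adj_dist_eq_add_one {V : Type*} {G : SimpleGraph V}
    (hG : G.Connected) {σ v : V} (hv : v ≠ σ) :
    ∃ w, G.Adj w v ∧ G.dist σ v = G.dist σ w + 1 := by
  obtain ⟨p, hp⟩ := hG.exists_walk_length_eq_dist v σ
  cases p with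
  | nil => exact absurd rfl hv
  | @cons _ w _ h q =>
    refine ⟨w, h.symm, ?_⟩
    rw [Walk.length_cons] at hp
    have h₁ := dist_le q
    have h₂ := hG.dist_triangle (u := σ) (v := w) (w := v)
    rw [dist_eq_one_iff_adj.mpr h.symm] at h₂
    rw [dist_comm (u := v)] at hp
    rw [dist_comm (u := w)] at h₁
    omega

variable {V : Type*} [Fintype V] [DecidableEq V] {G : SimpleGraph V} [DecidableRel G.Adj]
  {σ : V} {β : V → ℝ}

theorem Connected.pathDegreeProd_pos (hG : G.Connected)
    (hβ : ∀ (v : V) (p : G.Walk σ v), p.IsPath →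
      β v = ∏ w ∈ p.support.toFinset.erase v, (G.degree w : ℝ)) (v : V) : 0 < β v := by
  obtain ⟨p, hp, -⟩ := hG.exists_path_of_dist σ v
  rw [hβ v p hp]
  refine Finset.prod_pos fun w hw => ?_
  have : Nontrivial V := ⟨w, v, Finset.ne_of_mem_erase hw⟩
  exact_mod_cast hG.preconnected.degree_pos_of_nontrivial w

theorem Connected.pathDegreeProd_eq_mul_degree (hG : G.Connected)
    (hβ : ∀ (v : V) (p : G.Walk σ v), p.IsPath →
      β v = ∏ w ∈ p.support.toFinset.erase v, (G.degree w : ℝ))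
    {v c : V} (hvc : G.Adj v c) (hd : G.dist σ c = G.dist σ v + 1) :
    β c = β v * G.degree v := by
  obtain ⟨p, hp, hlen⟩ := hG.exists_path_of_dist σ v
  have hq : (p.concat hvc).IsPath :=
    Walk.isPath_of_length_eq_dist _ (by rw [Walk.length_concat, hlen, hd])
  have hc : c ∉ p.support := ((Walk.concat_isPath_iff hvc).mp hq).2
  have hs : (p.concat hvc).support.toFinset.erase c = p.support.toFinset := by
    ext w
    simp only [Walk.support_concat, List.toFinset_append,
      Finset.mem_erase, Finset.mem_union, List.mem_toFinset, List.mem_singleton]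
    grind
  rw [hβ c _ hq, hβ v p hp, hs, Finset.prod_erase_mul]
  simp

open scoped Classical in
/-- A Kraft-type inequality: the reciprocals of the degree products over the leaves of a rooted
connected graph sum to at most `1`. -/
theorem Connected.sum_leaves_inv_pathDegreeProd_le_one (hG : G.Connected)
    (hβ : ∀ (v : V) (p : G.Walk σ v), p.IsPath →
      β v = ∏ w ∈ p.support.toFinset.erase v, (G.degree w : ℝ)) :
    ∑ v with ∀ w, G.Adj v w → G.dist σ w ≠ G.dist σ v + 1, (β v)⁻¹ ≤ 1 := by
  have hpos := hG.pathDegreeProd_pos hβ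
  have hroot : β σ = 1 := by simpa using hβ σ Walk.nil Walk.IsPath.nil
  have hparent : ∑ c ∈ Finset.univ.erase σ, (β c)⁻¹ ≤
      ∑ c, ∑ v with G.Adj v c ∧ G.dist σ c = G.dist σ v + 1, (β c)⁻¹ := by
    refine (Finset.sum_le_sum fun c hc => ?_).trans
      (Finset.sum_le_sum_of_subset_of_nonneg (Finset.subset_univ _) fun c _ _ =>
        Finset.sum_nonneg fun v _ => (inv_pos.mpr (hpos c)).le)
    obtain ⟨w, hw⟩ := hG.exists_adj_dist_eq_add_one (Finset.ne_of_mem_erase hc)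
    exact Finset.single_le_sum (f := fun _ => (β c)⁻¹) (fun _ _ => (inv_pos.mpr (hpos c)).le)
      (Finset.mem_filter.mpr ⟨Finset.mem_univ w, hw⟩)
  have hchildren : ∀ v, ∑ c with G.Adj v c ∧ G.dist σ c = G.dist σ v + 1, (β c)⁻¹ ≤
      if ¬∀ w, G.Adj v w → G.dist σ w ≠ G.dist σ v + 1 then (β v)⁻¹ else 0 := by
    intro v
    split_ifs with hleaf
    · exact (Finset.sum_eq_zero fun c hc => by
        have := (Finset.mem_filter.mp hc).2
        exact absurd this.2 (hleaf c this.1)).le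
    · push Not at hleaf
      obtain ⟨w, hw, -⟩ := hleaf
      have hdeg : (0 : ℝ) < G.degree v := by
        exact_mod_cast (G.degree_pos_iff_exists_adj v).mpr ⟨w, hw⟩
      calc ∑ c with G.Adj v c ∧ G.dist σ c = G.dist σ v + 1, (β c)⁻¹
          = ∑ c with G.Adj v c ∧ G.dist σ c = G.dist σ v + 1, (β v * G.degree v)⁻¹ :=
            Finset.sum_congr rfl fun c hc => by
              have := (Finset.mem_filter.mp hc).2
              rw [hG.pathDegreeProd_eq_mul_degree hβ this.1 this.2]
        _ ≤ ∑ c ∈ G.neighborFinset v, (β v * G.degree v)⁻¹ :=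
            Finset.sum_le_sum_of_subset_of_nonneg
              (fun c hc => (G.mem_neighborFinset v c).mpr (Finset.mem_filter.mp hc).2.1)
              fun _ _ _ => (inv_pos.mpr (mul_pos (hpos v) hdeg)).le
        _ = (β v)⁻¹ := by
            rw [Finset.sum_const, card_neighborFinset_eq_degree, nsmul_eq_mul]
            field_simp
  have hcomm : ∑ c, ∑ v with G.Adj v c ∧ G.dist σ c = G.dist σ v + 1, (β c)⁻¹ =
      ∑ v, ∑ c with G.Adj v c ∧ G.dist σ c = G.dist σ v + 1, (β c)⁻¹ :=
    Finset.sum_comm' (by simp)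
  have hle := hparent.trans (hcomm.trans_le (Finset.sum_le_sum fun v _ => hchildren v))
  have htotal := Finset.sum_erase_add Finset.univ (fun v => (β v)⁻¹) (Finset.mem_univ σ)
  have hsplit := Finset.sum_filter_add_sum_filter_not Finset.univ
    (fun v => ∀ w, G.Adj v w → G.dist σ w ≠ G.dist σ v + 1) (fun v => (β v)⁻¹)
  rw [← Finset.sum_filter] at hle
  simp only [hroot, inv_one] at htotal
  linarith

end SimpleGraph

open scoped Classical in
/-- For a finite rooted tree with root `σ`, where `β v` is the product of degrees along the path
from `σ` to `v` excluding `v`: for every real `B > 0`, the number of leaves `v`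
(vertices having no neighbor farther from the root) with `β v ≤ B` is at most `B`. -/
theorem stmt_8
    {V : Type*} [Fintype V] [DecidableEq V]
    (G : SimpleGraph V) [DecidableRel G.Adj] (hG : G.IsTree) (σ : V)
    (β : V → ℝ)
    (hβ : ∀ (v : V) (p : G.Walk σ v), p.IsPath →
      β v = ∏ w ∈ p.support.toFinset.erase v, (G.degree w : ℝ))
    (B : ℝ) (hB : 0 < B) :
    ((Finset.univ.filter
        (fun v => (∀ w, G.Adj v w → G.dist σ w ≠ G.dist σ v + 1) ∧ β v ≤ B)).card : ℝ)
      ≤ B := by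
  have hpos := hG.connected.pathDegreeProd_pos hβ
  have hkraft := hG.connected.sum_leaves_inv_pathDegreeProd_le_one hβ
  rw [← Finset.filter_filter]
  set L := Finset.univ.filter fun v => ∀ w, G.Adj v w → G.dist σ w ≠ G.dist σ v + 1
  have hcard : ((L.filter fun v => β v ≤ B).card : ℝ) * B⁻¹ ≤ 1 :=
    calc ((L.filter fun v => β v ≤ B).card : ℝ) * B⁻¹
        = ∑ v ∈ L with β v ≤ B, B⁻¹ := by rw [Finset.sum_const, nsmul_eq_mul]
      _ ≤ ∑ v ∈ L with β v ≤ B, (β v)⁻¹ :=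
          Finset.sum_le_sum fun v hv => inv_anti₀ (hpos v) (Finset.mem_filter.mp hv).2
      _ ≤ ∑ v ∈ L, (β v)⁻¹ :=
          Finset.sum_le_sum_of_subset_of_nonneg (Finset.filter_subset _ _)
            fun v _ _ => (inv_pos.mpr (hpos v)).le
      _ ≤ 1 := by convert hkraft
  rwa [← div_eq_mul_inv, div_le_one hB] at hcard
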